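/- Fix a real λ ≥ 0, an integer L ≥ 1, a real δ with 0 ≤ δ < 1, and an integer k. Suppose that either (i) k ≥ L(ln L + λ), or (ii) δ > √((λ + ln 2)/(2L)) and k ≥ L · ln(1/(δ − √((λ + ln 2)/(2L)))). Then, when k balls are thrown into L bins uniformly at random, the probability that more than δL bins are empty is at most e^{−λ}. -/

import Mathlib

open scoped Classical

/-- The number of empty bins when ball `i` lands in bin `f i`. -/
noncomputable def emptyBins {k L : ℕ} (f : Fin k → Fin L) : ℕ :=
  (Finset.univ.filter (fun j : Fin L => ∀ i : Fin k, f i ≠ j)).card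

/-- Probability (under a uniformly random assignment of `k` balls to `L` bins)
that more than `δ·L` bins are empty. -/
noncomputable def probManyEmpty (k L : ℕ) (δ : ℝ) : ℝ :=
  ((Finset.univ.filter (fun f : Fin k → Fin L =>
      δ * L < (emptyBins f : ℝ))).card : ℝ) / (L : ℝ) ^ k

lemma bb_count {k L : ℕ} (S : Finset (Fin L)) :
    ((Finset.univ.filter (fun f : Fin k → Fin L => ∀ j ∈ S, ∀ i, f i ≠ j)).card : ℝ)
      ≤ (L : ℝ) ^ k * (Real.exp (-(k / L : ℝ))) ^ S.card := by
  have h1 : (Finset.univ.filter (fun f : Fin k → Fin L => ∀ j ∈ S, ∀ i, f i ≠ j))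
      = Fintype.piFinset (fun _ : Fin k => Sᶜ) := by
    ext f
    simp only [Finset.mem_filter, Finset.mem_univ, true_and, Fintype.mem_piFinset,
      Finset.mem_compl]
    constructor
    · intro h i hi
      exact h _ hi i rfl
    · intro h j hj i hij
      exact h i (hij ▸ hj)
  have hc : S.card ≤ L := by simpa using Finset.card_le_univ S
  rw [h1, Fintype.card_piFinset_const, Finset.card_compl, Fintype.card_fin]
  push_cast [Nat.cast_sub hc]
  rcases Nat.eq_zero_or_pos L with h0 | hL
  · have : S.card = 0 := by omega
    simp [this, h0]
  have hL' : (0 : ℝ) < L := by exact_mod_cast hL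
  have h2 : (L : ℝ) - S.card ≤ L * Real.exp (-(S.card / L : ℝ)) := by
    have := Real.add_one_le_exp (-(S.card / L : ℝ))
    calc (L : ℝ) - S.card = L * (-(S.card / L : ℝ) + 1) := by field_simp; ring
      _ ≤ _ := by gcongr
  have h3 : (0 : ℝ) ≤ (L : ℝ) - S.card := by
    have : (S.card : ℝ) ≤ L := by exact_mod_cast hc
    linarith
  calc ((L : ℝ) - S.card) ^ k ≤ (L * Real.exp (-(S.card / L : ℝ))) ^ k := by gcongr
    _ = _ := by
      rw [mul_pow, ← Real.exp_nat_mul, ← Real.exp_nat_mul]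
      congr 2
      field_simp

lemma bb_pow {k L : ℕ} (x : ℝ) (f : Fin k → Fin L) :
    (1 + x) ^ emptyBins f
      = ∑ S : Finset (Fin L), if (∀ j ∈ S, ∀ i, f i ≠ j) then x ^ S.card else 0 := by
  unfold emptyBins
  rw [add_comm, ← Finset.sum_pow_mul_eq_add_pow, ← Finset.sum_filter]
  simp only [one_pow, mul_one]
  apply Finset.sum_congr _ (fun _ _ => rfl)
  ext S
  simp [Finset.subset_iff]

lemma bb_mgf {k L : ℕ} (x q : ℝ) (hx : 0 ≤ x) (hq : Real.exp (-(k / L : ℝ)) ≤ q) :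
    ∑ f : Fin k → Fin L, (1 + x) ^ emptyBins f ≤ (L : ℝ) ^ k * (1 + x * q) ^ L := by
  simp_rw [bb_pow]
  rw [Finset.sum_comm]
  have h : ∀ S : Finset (Fin L),
      (∑ f : Fin k → Fin L, if (∀ j ∈ S, ∀ i, f i ≠ j) then x ^ S.card else 0)
        ≤ (L : ℝ) ^ k * (x * q) ^ S.card := by
    intro S
    rw [← Finset.sum_filter, Finset.sum_const, nsmul_eq_mul]
    calc _ ≤ ((L : ℝ) ^ k * (Real.exp (-(k / L : ℝ))) ^ S.card) * x ^ S.card := by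
          gcongr
          exact bb_count S
      _ ≤ ((L : ℝ) ^ k * q ^ S.card) * x ^ S.card := by gcongr
      _ = _ := by rw [mul_pow]; ring
  refine (Finset.sum_le_sum fun S _ => h S).trans_eq ?_
  rw [← Finset.mul_sum]
  congr 1
  have := Finset.sum_pow_mul_eq_add_pow (x * q) 1 (Finset.univ : Finset (Fin L))
  simp only [one_pow, mul_one, Finset.card_univ, Fintype.card_fin, Finset.powerset_univ] at this
  rw [this, add_comm]

open MeasureTheory ProbabilityTheory in
lemma bb_hoeffding (q s : ℝ) (h0 : 0 ≤ q) (h1 : q ≤ 1) :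
    1 + (Real.exp s - 1) * q ≤ Real.exp (q * s + s ^ 2 / 8) := by
  let μ : Measure Bool := ENNReal.ofReal q • Measure.dirac true
    + ENNReal.ofReal (1 - q) • Measure.dirac false
  have hμ : IsProbabilityMeasure μ := ⟨by
    simp only [μ, Measure.add_apply, Measure.smul_apply, measure_univ, smul_eq_mul, mul_one]
    rw [← ENNReal.ofReal_add h0 (by linarith)]
    simp⟩
  have hint : ∀ g : Bool → ℝ, ∫ b, g b ∂μ = q * g true + (1 - q) * g false := by
    intro g
    simp only [μ]
    rw [integral_add_measure (Integrable.smul_measure Integrable.of_finite ENNReal.ofReal_ne_top)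
        (Integrable.smul_measure Integrable.of_finite ENNReal.ofReal_ne_top),
      integral_smul_measure, integral_smul_measure, integral_dirac, integral_dirac,
      ENNReal.toReal_ofReal h0, ENNReal.toReal_ofReal (by linarith)]
    simp
  let X : Bool → ℝ := fun b => if b then 1 else 0
  have hX := hasSubgaussianMGF_of_mem_Icc (μ := μ) (X := X) (a := 0) (b := 1)
    (measurable_of_finite X).aemeasurable (Filter.Eventually.of_forall fun b => by
      cases b <;> simp [X])
  have := hX.mgf_le s
  rw [mgf, hint, hint] at this
  simp [X] at this
  have e1 : Real.exp (s * (1 - q)) = Real.exp s * Real.exp (-(q * s)) := by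
    rw [← Real.exp_add]; ring_nf
  have e2 : Real.exp (-(s * q)) = Real.exp (-(q * s)) := by ring_nf
  rw [e1, e2] at this
  have e3 : Real.exp (q * s + s ^ 2 / 8) = Real.exp (q * s) * Real.exp (2⁻¹ ^ 2 * s ^ 2 / 2) := by
    rw [← Real.exp_add]; ring_nf
  have e4 : Real.exp (q * s) * Real.exp (-(q * s)) = 1 := by
    rw [← Real.exp_add]; simp
  rw [e3]
  calc 1 + (Real.exp s - 1) * q
      = Real.exp (q * s) * (q * (Real.exp s * Real.exp (-(q * s)))
        + (1 - q) * Real.exp (-(q * s))) := by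
        linear_combination (-(1 + (Real.exp s - 1) * q)) * e4
    _ ≤ _ := by
        gcongr
        simpa using this

theorem balls_and_bins (lam : ℝ) (hlam : 0 ≤ lam) (L : ℕ) (hL : 1 ≤ L)
    (δ : ℝ) (hδ0 : 0 ≤ δ) (hδ1 : δ < 1) (k : ℕ)
    (hk : (L : ℝ) * (Real.log L + lam) ≤ (k : ℝ) ∨
      (Real.sqrt ((lam + Real.log 2) / (2 * L)) < δ ∧
        (L : ℝ) * Real.log (1 / (δ - Real.sqrt ((lam + Real.log 2) / (2 * L)))) ≤ (k : ℝ))) :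
    probManyEmpty k L δ ≤ Real.exp (-lam) := by
  have hL' : (0 : ℝ) < L := by exact_mod_cast hL
  unfold probManyEmpty
  rw [div_le_iff₀ (by positivity)]
  rcases hk with hk | ⟨hd, hk⟩
  · have hsub : (Finset.univ.filter (fun f : Fin k → Fin L => δ * L < (emptyBins f : ℝ)))
        ⊆ Finset.univ.biUnion (fun j : Fin L =>
          Finset.univ.filter (fun f : Fin k → Fin L => ∀ j' ∈ ({j} : Finset (Fin L)), ∀ i, f i ≠ j')) := by
      intro f hf
      simp only [Finset.mem_filter, Finset.mem_univ, true_and] at hf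
      have hpos : 0 < emptyBins f := by
        have : (0 : ℝ) < emptyBins f := lt_of_le_of_lt (by positivity) hf
        exact_mod_cast this
      obtain ⟨j, hj⟩ := Finset.card_pos.mp hpos
      simp only [Finset.mem_filter, Finset.mem_univ, true_and] at hj
      simp only [Finset.mem_biUnion, Finset.mem_filter, Finset.mem_univ, true_and,
        Finset.mem_singleton, forall_eq]
      exact ⟨j, hj⟩
    have h1 := (Finset.card_le_card hsub).trans Finset.card_biUnion_le
    have h2 : ((Finset.univ.filter (fun f : Fin k → Fin L => δ * L < (emptyBins f : ℝ))).card : ℝ)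
        ≤ ∑ j : Fin L, ((L : ℝ) ^ k * Real.exp (-(k / L : ℝ))) := by
      refine (Nat.cast_le.mpr h1).trans ?_
      rw [Nat.cast_sum]
      refine Finset.sum_le_sum fun j _ => ?_
      simpa only [Finset.card_singleton, pow_one] using bb_count (k := k) ({j} : Finset (Fin L))
    refine h2.trans ?_
    rw [Finset.sum_const, Finset.card_univ, Fintype.card_fin, nsmul_eq_mul]
    have h3 : Real.exp (-(k / L : ℝ)) ≤ Real.exp (-lam) / L := by
      rw [le_div_iff₀ hL']
      nth_rewrite 2 [← Real.exp_log hL']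
      rw [← Real.exp_add]
      apply Real.exp_le_exp.mpr
      have : Real.log L + lam ≤ k / L := by
        rw [le_div_iff₀ hL']; linarith
      linarith
    calc (L : ℝ) * ((L : ℝ) ^ k * Real.exp (-(k / L : ℝ)))
        ≤ (L : ℝ) * ((L : ℝ) ^ k * (Real.exp (-lam) / L)) := by gcongr
      _ = _ := by field_simp
  · set t := Real.sqrt ((lam + Real.log 2) / (2 * L)) with ht
    have hlog2 : 0 < Real.log 2 := Real.log_pos (by norm_num)
    have ht0 : 0 ≤ t := Real.sqrt_nonneg _
    have ht2 : t ^ 2 * (2 * L) = lam + Real.log 2 := by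
      rw [ht, Real.sq_sqrt (by positivity)]; field_simp
    have hq0 : 0 < δ - t := by linarith
    have hq : Real.exp (-(k / L : ℝ)) ≤ δ - t := by
      rw [← Real.le_log_iff_exp_le hq0]
      rw [one_div, Real.log_inv] at hk
      have : -Real.log (δ - t) ≤ k / L := by
        rw [le_div_iff₀ hL']; linarith
      linarith
    have hs : (0 : ℝ) ≤ 4 * t := by positivity
    have hx : 0 ≤ Real.exp (4 * t) - 1 := by
      have := Real.one_le_exp hs
      linarith
    have hm := bb_mgf (k := k) (L := L) _ _ hx hq
    have hh := bb_hoeffding (δ - t) (4 * t) hq0.le (by linarith)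
    have hlow : ((Finset.univ.filter (fun f : Fin k → Fin L => δ * L < (emptyBins f : ℝ))).card : ℝ)
        * Real.exp (4 * t * (δ * L)) ≤
        ∑ f : Fin k → Fin L, (1 + (Real.exp (4 * t) - 1)) ^ emptyBins f := by
      rw [← nsmul_eq_mul, ← Finset.sum_const]
      refine (Finset.sum_le_sum (fun f hf => ?_)).trans
        (Finset.sum_le_sum_of_subset_of_nonneg (Finset.filter_subset _ _)
          (fun f _ _ => by positivity))
      simp only [Finset.mem_filter, Finset.mem_univ, true_and] at hf
      rw [add_sub_cancel, ← Real.exp_nat_mul]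
      apply Real.exp_le_exp.mpr
      rw [mul_comm (emptyBins f : ℝ)]
      gcongr
    have hup : (L : ℝ) ^ k * (1 + (Real.exp (4 * t) - 1) * (δ - t)) ^ L
        ≤ (Real.exp (-lam) * (L : ℝ) ^ k) * Real.exp (4 * t * (δ * L)) := by
      calc _ ≤ (L : ℝ) ^ k * (Real.exp ((δ - t) * (4 * t) + (4 * t) ^ 2 / 8)) ^ L := by gcongr
        _ = (L : ℝ) ^ k * Real.exp (4 * t * (δ * L) - t ^ 2 * (2 * L)) := by
          rw [← Real.exp_nat_mul]; ring_nf
        _ ≤ (L : ℝ) ^ k * Real.exp (4 * t * (δ * L) + -lam) := by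
          gcongr
          linarith
        _ = _ := by rw [Real.exp_add]; ring
    exact le_of_mul_le_mul_right (hlow.trans (hm.trans hup)) (Real.exp_pos _)
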